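/- Let G be a finitely generated group with the word metric and let H ≤ G be a subgroup of finite index n. If H (with the metric restricted from G) admits an n-to-1 self quasi-isometry, then there exists a bijective quasi-isometry from H to G. -/

import Mathlib

open Filter

/-- The word length of `g` with respect to a generating set `S`: the least `n` such that `g`
is a product of `n` elements of `S ∪ S⁻¹`. -/
noncomputable def wordLength {G : Type*} [Group G] (S : Set G) (g : G) : ℕ :=
  sInf {n : ℕ | ∃ w : List G, w.length = n ∧ (∀ x ∈ w, x ∈ S ∨ x⁻¹ ∈ S) ∧ w.prod = g}

/-- The word metric `d(x,y) = ‖x⁻¹y‖` with respect to the generating set `S`. -/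
noncomputable def wordDist {G : Type*} [Group G] (S : Set G) (x y : G) : ℝ :=
  (wordLength S (x⁻¹ * y) : ℝ)

/-- Distance from a point to a set in the word metric. -/
noncomputable def setDist {G : Type*} [Group G] (S : Set G) (x : G) (A : Set G) : ℝ :=
  sInf ((fun a => wordDist S x a) '' A)

/-- The boundary `∂A = {x ∈ G : 0 < d(x,A) ≤ 1}`. -/
def wordBoundary {G : Type*} [Group G] (S : Set G) (A : Set G) : Set G :=
  {x : G | 0 < setDist S x A ∧ setDist S x A ≤ 1}

/-- A Folner sequence: nonempty finite subsets `F i` with `|∂F i| / |F i| → 0`. -/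
def IsFolner {G : Type*} [Group G] (S : Set G) (F : ℕ → Finset G) : Prop :=
  (∀ i, (F i).Nonempty) ∧
  Filter.Tendsto
    (fun i => ((wordBoundary S ((F i : Set G))).ncard : ℝ) / ((F i).card : ℝ))
    Filter.atTop (nhds 0)

/-- A `(K,C)` quasi-isometry between spaces with distance functions `dX`, `dY`:
`-C + dX x x' / K ≤ dY (f x) (f x') ≤ K * dX x x' + C`, and the image is `C`-dense. -/
def IsQuasiIsometry {X Y : Type*} (dX : X → X → ℝ) (dY : Y → Y → ℝ) (f : X → Y) : Prop :=
  ∃ K C : ℝ, 1 ≤ K ∧ 0 ≤ C ∧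
    (∀ x x' : X, -C + dX x x' / K ≤ dY (f x) (f x') ∧ dY (f x) (f x') ≤ K * dX x x' + C) ∧
    (∀ y : Y, ∃ x : X, dY (f x) y ≤ C)

theorem exists_word {G : Type*} [Group G] {S : Set G} (hS : Subgroup.closure S = ⊤) (g : G) :
    ∃ w : List G, w.length = wordLength S g ∧ (∀ x ∈ w, x ∈ S ∨ x⁻¹ ∈ S) ∧ w.prod = g := by
  have hg : g ∈ Submonoid.closure (S ∪ S⁻¹) := by
    rw [← Subgroup.closure_toSubmonoid, hS]
    trivial
  obtain ⟨l, hl, hp⟩ := Submonoid.exists_list_of_mem_closure hg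
  exact Nat.sInf_mem (s := {n : ℕ | ∃ w : List G, w.length = n ∧
    (∀ x ∈ w, x ∈ S ∨ x⁻¹ ∈ S) ∧ w.prod = g}) ⟨l.length, l, rfl, fun x hx => hl x hx, hp⟩

theorem wordLength_mul_le {G : Type*} [Group G] {S : Set G} (hS : Subgroup.closure S = ⊤)
    (g h : G) : wordLength S (g * h) ≤ wordLength S g + wordLength S h := by
  obtain ⟨u, hu, hu2, hu3⟩ := exists_word hS g
  obtain ⟨v, hv, hv2, hv3⟩ := exists_word hS h
  refine Nat.sInf_le ⟨u ++ v, by simp [hu, hv], ?_, by simp [hu3, hv3]⟩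
  intro x hx
  rcases List.mem_append.1 hx with hx | hx
  · exact hu2 x hx
  · exact hv2 x hx

theorem wordLength_one {G : Type*} [Group G] (S : Set G) : wordLength S (1 : G) = 0 :=
  Nat.le_zero.1 (Nat.sInf_le ⟨[], by simp⟩)

/-- If `H ≤ G` has finite index `n` in a finitely generated group `G`
(word metric) and `H` (restricted metric) admits an `n`-to-`1` self quasi-isometry, then there
is a bijective quasi-isometry from `H` to `G`. -/
theorem exists_bijective_quasiIsometry_of_n_to_one
    {G : Type*} [Group G] (S : Set G) (hSfin : S.Finite) (hSgen : Subgroup.closure S = ⊤)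
    (H : Subgroup G) (n : ℕ) (hn : 0 < n) (hindex : H.index = n)
    (hex : ∃ f : H → H,
      IsQuasiIsometry (fun a b : H => wordDist S (a : G) (b : G))
        (fun a b : H => wordDist S (a : G) (b : G)) f ∧
      ∀ y : H, (f ⁻¹' {y}).ncard = n) :
    ∃ b : H → G, Function.Bijective b ∧
      IsQuasiIsometry (fun a b' : H => wordDist S (a : G) (b' : G)) (wordDist S) b := by
  obtain ⟨f, ⟨K, C, hK, hC, hf, -⟩, hfib⟩ := hex
  obtain ⟨T, hT, -⟩ := H.exists_isComplement_right 1
  have hcard : Nat.card T = n := hT.card_right.trans hindex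
  have hTfin : Finite T := Nat.finite_of_card_ne_zero (by omega)
  have he : ∀ y : H, Nonempty ({x : H // f x = y} ≃ T) := by
    intro y
    have h1 : Nat.card {x : H // f x = y} = n := by
      rw [← hfib y, ← Nat.card_coe_set_eq]
      rfl
    have h2 : Finite {x : H // f x = y} := Nat.finite_of_card_ne_zero (by omega)
    exact (Finite.card_eq).1 (h1.trans hcard.symm)
  let e := fun y => Classical.choice (he y)
  let φ : H ≃ G := (Equiv.sigmaFiberEquiv f).symm.trans <| (Equiv.sigmaCongrRight e).trans <|
    (Equiv.sigmaEquivProd H T).trans <| Equiv.ofBijective _ hT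
  have hφ : ∀ x, ∃ t : T, φ x = (f x : G) * (t : G) := fun x => ⟨e (f x) ⟨x, rfl⟩, rfl⟩
  obtain ⟨D, hD⟩ : ∃ D : ℕ, ∀ t : T, wordLength S (t : G) ≤ D ∧ wordLength S (t : G)⁻¹ ≤ D := by
    obtain ⟨D, hD⟩ := (Set.finite_range
      (fun t : T => wordLength S (t : G) + wordLength S (t : G)⁻¹)).bddAbove
    refine ⟨D, fun t => ?_⟩
    have := hD ⟨t, rfl⟩
    simp only at this
    omega
  refine ⟨φ, φ.bijective, K, C + 2 * D, hK, by positivity, ?_, ?_⟩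
  · intro x x'
    obtain ⟨t, ht⟩ := hφ x
    obtain ⟨t', ht'⟩ := hφ x'
    obtain ⟨h1, h2⟩ := hf x x'
    beta_reduce at h1 h2 ⊢
    have hup : wordDist S (φ x) (φ x') ≤ wordDist S (f x : G) (f x') + 2 * D := by
      have a1 := wordLength_mul_le hSgen ((t : G)⁻¹ * ((f x : G)⁻¹ * f x')) t'
      have a2 := wordLength_mul_le hSgen (t : G)⁻¹ ((f x : G)⁻¹ * f x')
      have a3 := (hD t).2
      have a4 := (hD t').1
      have a5 : (φ x)⁻¹ * φ x' = (t : G)⁻¹ * ((f x : G)⁻¹ * f x') * t' := by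
        rw [ht, ht']; group
      unfold wordDist
      rw [a5]
      rify at a1 a2 a3 a4
      linarith
    have hlo : wordDist S (f x : G) (f x') ≤ wordDist S (φ x) (φ x') + 2 * D := by
      have a1 := wordLength_mul_le hSgen ((t : G) * ((φ x)⁻¹ * φ x')) (t' : G)⁻¹
      have a2 := wordLength_mul_le hSgen (t : G) ((φ x)⁻¹ * φ x')
      have a3 := (hD t).1
      have a4 := (hD t').2
      have a5 : (f x : G)⁻¹ * f x' = (t : G) * ((φ x)⁻¹ * φ x') * (t' : G)⁻¹ := by
        rw [ht, ht']; group
      unfold wordDist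
      rw [a5]
      rify at a1 a2 a3 a4
      linarith
    constructor <;> linarith
  · intro y
    refine ⟨φ.symm y, ?_⟩
    simp only [Equiv.apply_symm_apply, wordDist, inv_mul_cancel, wordLength_one, Nat.cast_zero]
    positivity
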